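/- Let μ = μ₁⊗⋯⊗μ_k be a product probability measure and let f : V → ℝ have degree at most d and be (d,δ)-global. Then ‖f‖₄⁴ ≤ δ·2000^d·‖f‖₂². -/

import Mathlib

open Finset

namespace GLL

variable {k : ℕ} {V : Fin k → Type} [∀ i, Fintype (V i)] [∀ i, DecidableEq (V i)]

/-- Expectation of `f` with respect to the (finitely supported) measure `μ`. -/
def expect (μ f : (∀ i, V i) → ℝ) : ℝ := ∑ x, μ x * f x

/-- `μ` is a probability measure. -/
def IsProb (μ : (∀ i, V i) → ℝ) : Prop := (∀ x, 0 ≤ μ x) ∧ ∑ x, μ x = 1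

/-- The marginal `μ_S` evaluated at (the `S`-coordinates of) `x`. -/
def marg (μ : (∀ i, V i) → ℝ) (S : Finset (Fin k)) (x : ∀ i, V i) : ℝ :=
  ∑ z, if ∀ i ∈ S, z i = x i then μ z else 0

/-- The link (conditional) measure `μ_x` for `x ∈ V_S`, viewed as a measure on
full points agreeing with `x` on `S`. -/
noncomputable def cond (μ : (∀ i, V i) → ℝ) (S : Finset (Fin k)) (x z : ∀ i, V i) : ℝ :=
  if ∀ i ∈ S, z i = x i then μ z / marg μ S x else 0

/-- The averaging operator `A_S`: `A_S f (x) = E_{y ∼ μ_{x_S}} [f(x_S, y)]`.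
Applied to an `S'`-junta `f`, this is also the operator `A_{S',S}`. -/
noncomputable def Aop (μ : (∀ i, V i) → ℝ) (S : Finset (Fin k)) (f : (∀ i, V i) → ℝ)
    (x : ∀ i, V i) : ℝ :=
  ∑ z, cond μ S x z * f z

/-- The Efron–Stein component `f^{=S} = ∑_{T ⊆ S} (-1)^{|S∖T|} A_T f`. -/
noncomputable def ES (μ : (∀ i, V i) → ℝ) (S : Finset (Fin k)) (f : (∀ i, V i) → ℝ)
    (x : ∀ i, V i) : ℝ :=
  ∑ T ∈ S.powerset, (-1 : ℝ) ^ (S.card - T.card) * Aop μ T f x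

/-- The low-degree part `f^{≤ d} = ∑_{|S| ≤ d} f^{=S}`. -/
noncomputable def lowPart (μ : (∀ i, V i) → ℝ) (d : ℕ) (f : (∀ i, V i) → ℝ)
    (x : ∀ i, V i) : ℝ :=
  ∑ S ∈ univ.powerset.filter (fun S : Finset (Fin k) => S.card ≤ d), ES μ S f x

/-- The Laplacian `L_S[f] = ∑_{T ⊇ S} f^{=T}`. -/
noncomputable def Lap (μ : (∀ i, V i) → ℝ) (S : Finset (Fin k)) (f : (∀ i, V i) → ℝ)
    (x : ∀ i, V i) : ℝ :=
  ∑ T ∈ univ.powerset.filter (fun T : Finset (Fin k) => S ⊆ T), ES μ T f x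

/-- The truncated Laplacian `L_S^{≤d}[f] = ∑_{T ⊇ S, |T| ≤ d} f^{=T}`. -/
noncomputable def LapLe (μ : (∀ i, V i) → ℝ) (d : ℕ) (S : Finset (Fin k))
    (f : (∀ i, V i) → ℝ) (x : ∀ i, V i) : ℝ :=
  ∑ T ∈ univ.powerset.filter (fun T : Finset (Fin k) => S ⊆ T ∧ T.card ≤ d), ES μ T f x

/-- The influence `I_{S,x}[f] = ‖L_S[f](x,·)‖²_{L²(μ_x)}`. -/
noncomputable def Inf (μ : (∀ i, V i) → ℝ) (S : Finset (Fin k)) (f : (∀ i, V i) → ℝ)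
    (x : ∀ i, V i) : ℝ :=
  ∑ z, cond μ S x z * (Lap μ S f z) ^ 2

/-- The truncated influence `I^{≤d}_{S,x}[f] = ‖L_S^{≤d}[f](x,·)‖²_{L²(μ_x)}`. -/
noncomputable def InfLe (μ : (∀ i, V i) → ℝ) (d : ℕ) (S : Finset (Fin k))
    (f : (∀ i, V i) → ℝ) (x : ∀ i, V i) : ℝ :=
  ∑ z, cond μ S x z * (LapLe μ d S f z) ^ 2

/-- `‖f‖₂²` with respect to `μ`. -/
def normSq (μ f : (∀ i, V i) → ℝ) : ℝ := ∑ x, μ x * (f x) ^ 2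

/-- `‖f‖₄⁴` with respect to `μ`. -/
def norm4p4 (μ f : (∀ i, V i) → ℝ) : ℝ := ∑ x, μ x * (f x) ^ 4

/-- `‖f‖₂` with respect to `μ`. -/
noncomputable def l2norm (μ f : (∀ i, V i) → ℝ) : ℝ := Real.sqrt (normSq μ f)

/-- `‖f‖_∞`: the maximum of `|f|` over the support of `μ`. -/
noncomputable def supNorm (μ f : (∀ i, V i) → ℝ) : ℝ :=
  sSup ((fun x => |f x|) '' {x | 0 < μ x})

/-- Inner product `⟨f, g⟩ = E_{x∼μ}[f(x) g(x)]`. -/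
def inner' (μ f g : (∀ i, V i) → ℝ) : ℝ := ∑ x, μ x * (f x * g x)

/-- The pair `{i,j}`-skeleton of `μ` is `ε`-pseudorandom. -/
def PairPseudo (μ : (∀ i, V i) → ℝ) (ε : ℝ) (i j : Fin k) : Prop :=
  ∀ (f₁ : V i → ℝ) (f₂ : V j → ℝ),
    |expect μ (fun x => f₁ (x i) * f₂ (x j)) -
        expect μ (fun x => f₁ (x i)) * expect μ (fun x => f₂ (x j))| ≤
      ε * Real.sqrt
        ((expect μ (fun x => f₁ (x i) ^ 2) - expect μ (fun x => f₁ (x i)) ^ 2) *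
          (expect μ (fun x => f₂ (x j) ^ 2) - expect μ (fun x => f₂ (x j)) ^ 2))

/-- `μ` is an `ε`-product measure: every link of every restriction of size `≤ k - 2`
has `ε`-pseudorandom skeletons. -/
def EpsProduct (μ : (∀ i, V i) → ℝ) (ε : ℝ) : Prop :=
  ∀ S : Finset (Fin k), S.card ≤ k - 2 → ∀ x, 0 < marg μ S x →
    ∀ i j : Fin k, i ∉ S → j ∉ S → i ≠ j → PairPseudo (cond μ S x) ε i j

/-- `‖f(x,·)‖_{L²(μ_x)}` for `x ∈ V_S`. -/
noncomputable def restrictNorm (μ : (∀ i, V i) → ℝ) (S : Finset (Fin k)) (x : ∀ i, V i)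
    (f : (∀ i, V i) → ℝ) : ℝ :=
  Real.sqrt (∑ z, cond μ S x z * (f z) ^ 2)

/-- `f` is `(d, δ)`-global: all restrictions of at most `d` coordinates have
`2`-norm at most `δ`. -/
def IsGlobal (μ : (∀ i, V i) → ℝ) (d : ℕ) (δ : ℝ) (f : (∀ i, V i) → ℝ) : Prop :=
  ∀ S : Finset (Fin k), S.card ≤ d → ∀ x, 0 < marg μ S x → restrictNorm μ S x f ≤ δ

/-- `f` is an `S`-junta: it depends only on the coordinates in `S`. -/
def Junta (S : Finset (Fin k)) (f : (∀ i, V i) → ℝ) : Prop :=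
  ∀ x y, (∀ i ∈ S, x i = y i) → f x = f y

/-- The noise operator `T_ρ f = ∑_{S ⊆ [k]} ρ^{|S|} (1-ρ)^{k-|S|} A_S f`. -/
noncomputable def noiseOp (μ : (∀ i, V i) → ℝ) (ρ : ℝ) (f : (∀ i, V i) → ℝ)
    (x : ∀ i, V i) : ℝ :=
  ∑ S ∈ (univ : Finset (Fin k)).powerset, ρ ^ S.card * (1 - ρ) ^ (k - S.card) * Aop μ S f x

/-- The up-down walk operator `T = (1/k) ∑_{i=1}^k A_{[k]∖{i}}`. -/
noncomputable def upDown (μ : (∀ i, V i) → ℝ) (f : (∀ i, V i) → ℝ) (x : ∀ i, V i) : ℝ :=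
  (1 / (k : ℝ)) * ∑ i : Fin k, Aop μ (univ.erase i) f x

/-- The product measure `μ₁ ⊗ ⋯ ⊗ μ_k`. -/
def prodMeasure (μi : ∀ i, V i → ℝ) : (∀ i, V i) → ℝ := fun x => ∏ i, μi i (x i)

/-- `f` has degree at most `d`: `f^{=S} = 0` whenever `|S| > d`. -/
def DegLe (μ : (∀ i, V i) → ℝ) (d : ℕ) (f : (∀ i, V i) → ℝ) : Prop :=
  ∀ S : Finset (Fin k), d < S.card → ∀ x, ES μ S f x = 0

/-- `{F S}_{S ⊆ [k]}` is an `(α, ε')`-approximate Efron–Stein decomposition of `f`. -/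
noncomputable def ApproxES (μ : (∀ i, V i) → ℝ) (α ε' : ℝ) (f : (∀ i, V i) → ℝ)
    (F : Finset (Fin k) → (∀ i, V i) → ℝ) : Prop :=
  l2norm μ f ≤ α ∧
    l2norm μ (fun x => f x - ∑ S ∈ (univ : Finset (Fin k)).powerset, F S x) ≤ ε' ∧
    ∀ S : Finset (Fin k), ∃ h : (∀ i, V i) → ℝ,
      l2norm μ h ≤ α ∧ l2norm μ (fun x => ES μ S h x - F S x) ≤ ε'

set_option linter.unusedSectionVars false

section Marginals

variable (μi : ∀ i, V i → ℝ)

theorem prodMeasure_nonneg (hnn : ∀ i x, 0 ≤ μi i x) (x : ∀ i, V i) : 0 ≤ prodMeasure μi x :=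
  prod_nonneg fun i _ => hnn i (x i)

theorem prodMeasure_pos_iff (hnn : ∀ i x, 0 ≤ μi i x) (x : ∀ i, V i) :
    0 < prodMeasure μi x ↔ ∀ i, 0 < μi i (x i) := by
  refine ⟨fun h i => (hnn i _).lt_of_ne fun h0 => h.ne' ?_, fun h => prod_pos fun i _ => h i⟩
  exact prod_eq_zero (mem_univ i) h0.symm

theorem sum_prodMeasure (hsum : ∀ i, ∑ x, μi i x = 1) : ∑ x, prodMeasure μi x = 1 := by
  have := Finset.prod_univ_sum (fun i => (univ : Finset (V i))) μi
  simp only [Fintype.piFinset_univ] at this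
  simp only [prodMeasure, ← this, hsum, prod_const_one]

theorem marg_prodMeasure (hsum : ∀ i, ∑ x, μi i x = 1) (S : Finset (Fin k)) (x : ∀ i, V i) :
    marg (prodMeasure μi) S x = ∏ i ∈ S, μi i (x i) := by
  have key := Finset.prod_univ_sum (fun i => (univ : Finset (V i)))
    (fun i v => if i ∈ S → v = x i then μi i v else 0)
  simp only [Fintype.piFinset_univ] at key
  have h1 : ∀ z : ∀ i, V i, (if ∀ i ∈ S, z i = x i then prodMeasure μi z else 0) =
      ∏ i, if i ∈ S → z i = x i then μi i (z i) else 0 := by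
    intro z
    split_ifs with h
    · exact prod_congr rfl fun i _ => (if_pos (h i)).symm
    · push Not at h
      obtain ⟨i, hi, hne⟩ := h
      exact (prod_eq_zero (mem_univ i) (if_neg fun h => hne (h hi))).symm
  rw [marg, sum_congr rfl fun z _ => h1 z, ← key, ← prod_subset (subset_univ S)]
  · refine prod_congr rfl fun i hi => ?_
    simp [hi]
  · intro i _ hi
    simp [hi, hsum]

theorem marg_mul_marg_compl (hsum : ∀ i, ∑ x, μi i x = 1) (S : Finset (Fin k)) (x : ∀ i, V i) :
    marg (prodMeasure μi) S x * marg (prodMeasure μi) Sᶜ x = prodMeasure μi x := by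
  rw [marg_prodMeasure μi hsum, marg_prodMeasure μi hsum, prodMeasure, prod_mul_prod_compl]

theorem marg_pos_of_prodMeasure_pos (hnn : ∀ i x, 0 ≤ μi i x) (hsum : ∀ i, ∑ x, μi i x = 1)
    (S : Finset (Fin k)) {x : ∀ i, V i} (hx : 0 < prodMeasure μi x) :
    0 < marg (prodMeasure μi) S x := by
  rw [marg_prodMeasure μi hsum]
  exact prod_pos fun i _ => (prodMeasure_pos_iff μi hnn x).1 hx i

theorem piecewise_eq_iff (S : Finset (Fin k)) (z w v : ∀ i, V i) :
    S.piecewise z w = v ↔ (∀ i ∈ S, z i = v i) ∧ ∀ i ∈ Sᶜ, w i = v i := by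
  constructor
  · rintro rfl
    refine ⟨fun i hi => ?_, fun i hi => ?_⟩
    · simp [hi]
    · simp [mem_compl.1 hi]
  · rintro ⟨h1, h2⟩
    ext i
    by_cases hi : i ∈ S
    · simp [hi, h1 i hi]
    · simp [hi, h2 i (mem_compl.2 hi)]

/-- Resampling the coordinates in `S` preserves the product measure. -/
theorem sum_sum_piecewise (hsum : ∀ i, ∑ x, μi i x = 1) (S : Finset (Fin k))
    (g : (∀ i, V i) → ℝ) :
    ∑ w, prodMeasure μi w * ∑ z, prodMeasure μi z * g (S.piecewise z w) =
      ∑ v, prodMeasure μi v * g v := by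
  have h1 : ∀ w z : ∀ i, V i, prodMeasure μi w * (prodMeasure μi z * g (S.piecewise z w)) =
      ∑ v, (if ∀ i ∈ S, z i = v i then prodMeasure μi z else 0) *
        (if ∀ i ∈ Sᶜ, w i = v i then prodMeasure μi w else 0) * g v := by
    intro w z
    rw [sum_eq_single (S.piecewise z w)]
    · obtain ⟨h1, h2⟩ := (piecewise_eq_iff S z w _).1 rfl
      rw [if_pos h1, if_pos h2]
      ring
    · intro v _ hv
      by_cases h1 : ∀ i ∈ S, z i = v i
      · by_cases h2 : ∀ i ∈ Sᶜ, w i = v i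
        · exact absurd ((piecewise_eq_iff S z w v).2 ⟨h1, h2⟩).symm hv
        · rw [if_neg h2]; ring
      · rw [if_neg h1]; ring
    · simp
  simp only [mul_sum, h1]
  rw [sum_congr rfl fun w _ => sum_comm, sum_comm]
  refine sum_congr rfl fun v _ => ?_
  rw [← marg_mul_marg_compl μi hsum S v, marg, marg]
  simp only [← sum_mul, ← mul_sum]

/-- Averaging over the coordinates in `U`. -/
def avg (U : Finset (Fin k)) : ((∀ i, V i) → ℝ) →ₗ[ℝ] ((∀ i, V i) → ℝ) where
  toFun f x := ∑ w, prodMeasure μi w * f (U.piecewise w x)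
  map_add' f g := by
    ext x
    simp [mul_add, sum_add_distrib]
  map_smul' c f := by
    ext x
    simp [mul_sum, mul_left_comm]

theorem avg_apply (U : Finset (Fin k)) (f : (∀ i, V i) → ℝ) (x : ∀ i, V i) :
    avg μi U f x = ∑ w, prodMeasure μi w * f (U.piecewise w x) := rfl

theorem expect_avg (hsum : ∀ i, ∑ x, μi i x = 1) (U : Finset (Fin k)) (f : (∀ i, V i) → ℝ) :
    expect (prodMeasure μi) (avg μi U f) = expect (prodMeasure μi) f :=
  sum_sum_piecewise μi hsum U f

theorem avg_empty (hsum : ∀ i, ∑ x, μi i x = 1) (f : (∀ i, V i) → ℝ) : avg μi ∅ f = f := by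
  ext x
  simp [avg_apply, ← sum_mul, sum_prodMeasure μi hsum]

theorem avg_avg (hsum : ∀ i, ∑ x, μi i x = 1) (U W : Finset (Fin k)) (f : (∀ i, V i) → ℝ) :
    avg μi U (avg μi W f) = avg μi (U ∪ W) f := by
  ext x
  rw [avg_apply μi (U ∪ W), ← sum_sum_piecewise μi hsum W, avg_apply]
  refine sum_congr rfl fun w _ => ?_
  rw [avg_apply]
  refine congrArg _ (sum_congr rfl fun z _ => ?_)
  congr 2
  ext i
  by_cases h1 : i ∈ W <;> by_cases h2 : i ∈ U <;> simp [h1, h2]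

theorem avg_mul_of_fixed (U : Finset (Fin k)) {g : (∀ i, V i) → ℝ} (hg : avg μi U g = g)
    (f : (∀ i, V i) → ℝ) : avg μi U (g * f) = g * avg μi U f := by
  have h : ∀ w x, g (U.piecewise w x) = g x := by
    intro w x
    rw [← hg, avg_apply, avg_apply]
    refine sum_congr rfl fun z _ => ?_
    rw [piecewise_piecewise_of_subset_right]
    exact subset_rfl
  ext x
  simp only [avg_apply, Pi.mul_apply, h, mul_sum]
  exact sum_congr rfl fun w _ => by ring

theorem avg_mono (hnn : ∀ i x, 0 ≤ μi i x) (U : Finset (Fin k)) {f g : (∀ i, V i) → ℝ}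
    (h : ∀ x, f x ≤ g x) (x : ∀ i, V i) : avg μi U f x ≤ avg μi U g x :=
  sum_le_sum fun w _ => mul_le_mul_of_nonneg_left (h _) (prodMeasure_nonneg μi hnn w)

theorem avg_nonneg (hnn : ∀ i x, 0 ≤ μi i x) (U : Finset (Fin k)) {f : (∀ i, V i) → ℝ}
    (h : ∀ x, 0 ≤ f x) (x : ∀ i, V i) : 0 ≤ avg μi U f x :=
  sum_nonneg fun w _ => mul_nonneg (prodMeasure_nonneg μi hnn w) (h _)

theorem avg_mul_sq_le (hnn : ∀ i x, 0 ≤ μi i x) (U : Finset (Fin k)) (f g : (∀ i, V i) → ℝ)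
    (x : ∀ i, V i) : avg μi U (f * g) x ^ 2 ≤ avg μi U (f * f) x * avg μi U (g * g) x := by
  refine sum_sq_le_sum_mul_sum_of_sq_le_mul _ (fun w _ => ?_) (fun w _ => ?_)
    fun w _ => le_of_eq ?_
  · exact mul_nonneg (prodMeasure_nonneg μi hnn w) (mul_self_nonneg _)
  · exact mul_nonneg (prodMeasure_nonneg μi hnn w) (mul_self_nonneg _)
  · simp only [Pi.mul_apply]
    ring

theorem avg_congr_support (hnn : ∀ i x, 0 ≤ μi i x) (U : Finset (Fin k))
    {f g : (∀ i, V i) → ℝ} (h : ∀ z, 0 < prodMeasure μi z → f z = g z) {x : ∀ i, V i}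
    (hx : 0 < prodMeasure μi x) : avg μi U f x = avg μi U g x := by
  refine sum_congr rfl fun w _ => ?_
  rcases (prodMeasure_nonneg μi hnn w).eq_or_lt with hw | hw
  · simp [← hw]
  · rw [h]
    rw [prodMeasure_pos_iff μi hnn] at hx hw ⊢
    intro i
    by_cases hi : i ∈ U <;> simp [hi, hx i, hw i]

theorem Aop_prodMeasure (hsum : ∀ i, ∑ x, μi i x = 1) (S : Finset (Fin k))
    (f : (∀ i, V i) → ℝ) {x : ∀ i, V i} (hx : 0 < marg (prodMeasure μi) S x) :
    Aop (prodMeasure μi) S f x = avg μi Sᶜ f x := by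
  have h1 : ∀ z, cond (prodMeasure μi) S x z * f z =
      ∑ w, if Sᶜ.piecewise w x = z then prodMeasure μi w * f z else 0 := by
    intro z
    rw [cond]
    split_ifs with h
    · rw [← marg_mul_marg_compl μi hsum S z]
      have : marg (prodMeasure μi) S z = marg (prodMeasure μi) S x := by
        rw [marg_prodMeasure μi hsum, marg_prodMeasure μi hsum]
        exact prod_congr rfl fun i hi => by rw [h i hi]
      rw [this, mul_div_cancel_left₀ _ hx.ne', marg, sum_mul]
      refine sum_congr rfl fun w _ => ?_
      rw [ite_mul, zero_mul]
      refine if_congr ?_ rfl rfl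
      rw [piecewise_eq_iff, compl_compl]
      exact ⟨fun h' => ⟨h', fun i hi => (h i hi).symm⟩, fun h' => h'.1⟩
    · rw [zero_mul]
      refine (sum_eq_zero fun w _ => if_neg fun hw => h fun i hi => ?_).symm
      rw [piecewise_eq_iff, compl_compl] at hw
      exact (hw.2 i hi).symm
  rw [Aop, sum_congr rfl fun z _ => h1 z, sum_comm]
  simp [avg_apply]

end Marginals

section Expect

variable {μ : (∀ i, V i) → ℝ}

theorem expect_mono (hμ : ∀ x, 0 ≤ μ x) {f g : (∀ i, V i) → ℝ}
    (h : ∀ x, 0 < μ x → f x ≤ g x) : expect μ f ≤ expect μ g := by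
  refine sum_le_sum fun x _ => ?_
  rcases (hμ x).eq_or_lt with hx | hx
  · simp [← hx]
  · exact mul_le_mul_of_nonneg_left (h x hx) hx.le

theorem expect_nonneg (hμ : ∀ x, 0 ≤ μ x) {f : (∀ i, V i) → ℝ} (h : ∀ x, 0 ≤ f x) :
    0 ≤ expect μ f :=
  sum_nonneg fun x _ => mul_nonneg (hμ x) (h x)

theorem expect_add (f g : (∀ i, V i) → ℝ) : expect μ (f + g) = expect μ f + expect μ g := by
  simp [expect, mul_add, sum_add_distrib]

theorem expect_smul (c : ℝ) (f : (∀ i, V i) → ℝ) : expect μ (c • f) = c * expect μ f := by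
  simp [expect, mul_sum, mul_left_comm]

theorem expect_sum {ι : Type*} (s : Finset ι) (f : ι → (∀ i, V i) → ℝ) :
    expect μ (∑ j ∈ s, f j) = ∑ j ∈ s, expect μ (f j) := by
  simp only [expect, Finset.sum_apply, mul_sum]
  exact sum_comm

end Expect

section Alternating

variable {M : Type*} [AddCommGroup M] [Module ℝ M]

/-- The Möbius transform of a function on the Boolean lattice. -/
def altSum (a : Finset (Fin k) → M) (T : Finset (Fin k)) : M :=
  ∑ R ∈ T.powerset, (-1 : ℝ) ^ (T.card - R.card) • a R

theorem altSum_insert (a : Finset (Fin k) → M) {i : Fin k} {T : Finset (Fin k)} (hi : i ∉ T) :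
    altSum a (insert i T) = altSum (fun R => a (insert i R)) T - altSum a T := by
  rw [altSum, sum_powerset_insert hi, add_comm, sub_eq_add_neg]
  congr 1
  · refine sum_congr rfl fun R hR => ?_
    have := mem_powerset.1 hR
    rw [card_insert_of_notMem hi, card_insert_of_notMem fun h => hi (this h),
      Nat.add_sub_add_right]
  · rw [altSum, ← sum_neg_distrib]
    refine sum_congr rfl fun R hR => ?_
    have := card_le_card (mem_powerset.1 hR)
    rw [card_insert_of_notMem hi, Nat.sub_add_comm this, pow_succ]
    simp

theorem sum_altSum (W : Finset (Fin k)) (a : Finset (Fin k) → M) :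
    ∑ T ∈ W.powerset, altSum a T = a W := by
  induction W using Finset.induction_on generalizing a with
  | empty => simp [altSum]
  | insert i W hi ih =>
    rw [sum_powerset_insert hi, ← sum_add_distrib, ← ih fun R => a (insert i R)]
    refine sum_congr rfl fun T hT => ?_
    rw [altSum_insert a fun h => hi (mem_powerset.1 hT h)]
    abel

end Alternating

section Components

variable (μi : ∀ i, V i → ℝ)

/-- The Efron–Stein component with respect to a product measure, defined through `avg`. -/
def comp (f : (∀ i, V i) → ℝ) (T : Finset (Fin k)) : (∀ i, V i) → ℝ :=
  altSum (fun R => avg μi Rᶜ f) T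

theorem sum_comp (hsum : ∀ i, ∑ x, μi i x = 1) (f : (∀ i, V i) → ℝ) :
    ∑ T, comp μi f T = f := by
  have := sum_altSum univ fun R => avg μi Rᶜ f
  rwa [powerset_univ, compl_univ, avg_empty μi hsum] at this

theorem avg_altSum (U : Finset (Fin k)) (a : Finset (Fin k) → (∀ i, V i) → ℝ)
    (T : Finset (Fin k)) : avg μi U (altSum a T) = altSum (fun R => avg μi U (a R)) T := by
  simp [altSum, map_sum]

theorem avg_comp_of_notMem (hsum : ∀ i, ∑ x, μi i x = 1) (f : (∀ i, V i) → ℝ) {i : Fin k}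
    {T : Finset (Fin k)} (hi : i ∉ T) : avg μi {i} (comp μi f T) = comp μi f T := by
  rw [comp, avg_altSum]
  refine sum_congr rfl fun R hR => ?_
  have : i ∈ Rᶜ := mem_compl.2 fun h => hi (mem_powerset.1 hR h)
  simp only [avg_avg μi hsum, union_eq_right.2 (singleton_subset_iff.2 this)]

theorem avg_comp_of_mem (hsum : ∀ i, ∑ x, μi i x = 1) (f : (∀ i, V i) → ℝ) {i : Fin k}
    {T : Finset (Fin k)} (hi : i ∈ T) : avg μi {i} (comp μi f T) = 0 := by
  rw [← insert_erase hi, comp, altSum_insert _ (notMem_erase i T), map_sub, avg_altSum,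
    avg_altSum, sub_eq_zero]
  refine sum_congr rfl fun R _ => ?_
  simp only [avg_avg μi hsum]
  congr 3
  ext j
  by_cases hj : j = i <;> simp [hj]

theorem ES_prodMeasure (hnn : ∀ i x, 0 ≤ μi i x) (hsum : ∀ i, ∑ x, μi i x = 1)
    (T : Finset (Fin k)) (f : (∀ i, V i) → ℝ) {x : ∀ i, V i} (hx : 0 < prodMeasure μi x) :
    ES (prodMeasure μi) T f x = comp μi f T x := by
  rw [ES, comp, altSum, Finset.sum_apply]
  refine sum_congr rfl fun R _ => ?_
  rw [Aop_prodMeasure μi hsum R f (marg_pos_of_prodMeasure_pos μi hnn hsum R hx)]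
  simp

end Components

section Hypercontractivity

variable (μi : ∀ i, V i → ℝ)

/-- Pythagoras for combinations of Efron–Stein components with distinct traces on `U`. -/
theorem avg_sq_sum (hsum : ∀ i, ∑ x, μi i x = 1) (U : Finset (Fin k))
    (F : Finset (Fin k) → (∀ i, V i) → ℝ) (hF0 : ∀ T, ∀ i ∈ T, avg μi {i} (F T) = 0)
    (hF1 : ∀ T, ∀ i ∉ T, avg μi {i} (F T) = F T) (c : Finset (Fin k) → ℝ)
    (𝒯 : Finset (Finset (Fin k))) (h𝒯 : ∀ T ∈ 𝒯, ∀ T' ∈ 𝒯, T ∩ U = T' ∩ U → T = T') :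
    avg μi U ((∑ T ∈ 𝒯, c T • F T) * ∑ T ∈ 𝒯, c T • F T) =
      ∑ T ∈ 𝒯, c T ^ 2 • avg μi U (F T * F T) := by
  have one : ∀ T T', ∀ i ∈ U, i ∈ T → i ∉ T' → avg μi U (F T' * F T) = 0 := by
    intro T T' i hU hT hT'
    rw [← union_eq_left.2 (singleton_subset_iff.2 hU), ← avg_avg μi hsum,
      avg_mul_of_fixed μi {i} (hF1 T' i hT'), hF0 T i hT, mul_zero, map_zero]
  rw [sum_mul_sum, map_sum]
  refine sum_congr rfl fun T hT => ?_
  rw [map_sum, sum_eq_single_of_mem T hT]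
  · rw [smul_mul_smul_comm, map_smul, sq]
  · intro T' hT' hne
    rw [smul_mul_smul_comm, map_smul]
    have : T ∩ U ≠ T' ∩ U := fun h => hne (h𝒯 T hT T' hT' h).symm
    obtain ⟨i, hi⟩ : ∃ i, ¬ (i ∈ T ∩ U ↔ i ∈ T' ∩ U) := by
      by_contra! h
      exact this (Finset.ext h)
    have hU : i ∈ U := by
      by_contra h
      simp [h] at hi
    by_cases h : i ∈ T
    · rw [mul_comm (F T), one T T' i hU h (by simpa [h, hU] using hi), smul_zero]
    · rw [one T' T i hU (by simpa [h, hU] using hi) h, smul_zero]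

/-- One-coordinate hypercontractive step with the remaining coordinates in `U` averaged in
`L²`. -/
theorem expect_sq_avg_step (hnn : ∀ i x, 0 ≤ μi i x) (hsum : ∀ i, ∑ x, μi i x = 1)
    (U : Finset (Fin k)) (i : Fin k) (a b : (∀ i, V i) → ℝ) (ha : avg μi {i} a = a)
    (hb : avg μi {i} b = 0) :
    expect (prodMeasure μi)
        (avg μi U ((a + (1 / 2 : ℝ) • b) * (a + (1 / 2 : ℝ) • b)) ^ 2) ≤
      expect (prodMeasure μi) (avg μi (insert i U) ((a + b) * (a + b)) ^ 2) +
        expect (prodMeasure μi) (avg μi U (b * b) ^ 2) := by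
  have comm : ∀ g, avg μi {i} (avg μi U g) = avg μi U (avg μi {i} g) := fun g => by
    rw [avg_avg μi hsum, avg_avg μi hsum, union_comm]
  set P := avg μi U (a * a) with hP
  set Q := avg μi U (a * b) with hQ
  set R := avg μi U (b * b) with hR
  have hP1 : avg μi {i} P = P := by rw [comm, avg_mul_of_fixed μi {i} ha, ha]
  have hQ0 : avg μi {i} Q = 0 := by
    rw [comm, avg_mul_of_fixed μi {i} ha, hb, mul_zero, map_zero]
  have hCS : ∀ x, Q x ^ 2 ≤ P x * R x := avg_mul_sq_le μi hnn U a b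
  have e1 : avg μi U ((a + (1 / 2 : ℝ) • b) * (a + (1 / 2 : ℝ) • b)) =
      P + Q + (1 / 4 : ℝ) • R := by
    have : (a + (1 / 2 : ℝ) • b) * (a + (1 / 2 : ℝ) • b) =
        a * a + a * b + (1 / 4 : ℝ) • (b * b) := by
      ext x
      simp only [Pi.mul_apply, Pi.add_apply, Pi.smul_apply, smul_eq_mul]
      ring
    rw [this, map_add, map_add, map_smul]
  have e2 : avg μi (insert i U) ((a + b) * (a + b)) = P + avg μi {i} R := by
    have : (a + b) * (a + b) = a * a + (2 : ℝ) • (a * b) + b * b := by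
      ext x
      simp only [Pi.mul_apply, Pi.add_apply, Pi.smul_apply, smul_eq_mul]
      ring
    rw [this, insert_eq, ← avg_avg μi hsum, map_add, map_add, map_add, map_add,
      map_smul, map_smul, ← hP, ← hQ, ← hR, hP1, hQ0, smul_zero, add_zero]
  rw [e1, e2, ← expect_avg μi hsum {i} ((P + Q + (1 / 4 : ℝ) • R) ^ 2),
    ← expect_avg μi hsum {i} (R ^ 2), ← expect_add]
  refine expect_mono (prodMeasure_nonneg μi hnn) fun x _ => ?_
  have le1 : ∀ x, ((P + Q + (1 / 4 : ℝ) • R) ^ 2) x ≤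
      (P * (P + (2 : ℝ) • Q + (2 : ℝ) • R) + R ^ 2) x := by
    intro x
    simp only [Pi.mul_apply, Pi.add_apply, Pi.smul_apply, Pi.pow_apply, smul_eq_mul]
    nlinarith [hCS x, sq_nonneg (2 * Q x - R x), sq_nonneg (R x)]
  refine (avg_mono μi hnn {i} le1 x).trans ?_
  rw [map_add, avg_mul_of_fixed μi {i} hP1, map_add, map_add, map_smul, map_smul, hP1, hQ0]
  simp only [Pi.mul_apply, Pi.add_apply, Pi.smul_apply, Pi.pow_apply, smul_eq_mul,
    Pi.zero_apply]
  nlinarith [sq_nonneg (avg μi {i} R x)]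

/-- The Laplacian `L_S` of a family of components, with the coordinates in `R` amplified
by a factor of two. -/
def ampLap (F : Finset (Fin k) → (∀ i, V i) → ℝ) (S R : Finset (Fin k)) : (∀ i, V i) → ℝ :=
  ∑ T with S ⊆ T, (2 : ℝ) ^ (T ∩ R).card • F T

theorem ampLap_step (hnn : ∀ i x, 0 ≤ μi i x) (hsum : ∀ i, ∑ x, μi i x = 1)
    (F : Finset (Fin k) → (∀ i, V i) → ℝ) (hF0 : ∀ T, ∀ i ∈ T, avg μi {i} (F T) = 0)
    (hF1 : ∀ T, ∀ i ∉ T, avg μi {i} (F T) = F T) (U S R : Finset (Fin k)) {i : Fin k}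
    (hR : i ∉ R) :
    expect (prodMeasure μi) (avg μi U (ampLap F S R * ampLap F S R) ^ 2) ≤
      expect (prodMeasure μi)
          (avg μi (insert i U) (ampLap F S (insert i R) * ampLap F S (insert i R)) ^ 2) +
        expect (prodMeasure μi)
          (avg μi U (ampLap F (insert i S) (insert i R) * ampLap F (insert i S) (insert i R))
            ^ 2) := by
  set a : (∀ i, V i) → ℝ := ∑ T with S ⊆ T ∧ i ∉ T, (2 : ℝ) ^ (T ∩ R).card • F T with ha
  set b := ampLap F (insert i S) (insert i R) with hb
  have hb' : b = ∑ T with S ⊆ T ∧ i ∈ T, (2 : ℝ) ^ ((T ∩ R).card + 1) • F T := by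
    rw [hb, ampLap]
    refine sum_congr ?_ fun T hT => ?_
    · ext T
      simp [insert_subset_iff, and_comm]
    · rw [inter_insert_of_mem (mem_filter.1 hT).2.2, card_insert_of_notMem]
      simp [hR]
  have h1 : ampLap F S R = a + (1 / 2 : ℝ) • b := by
    rw [hb', smul_sum, ha, ampLap, ← sum_filter_not_add_sum_filter _ (fun T => i ∈ T),
      filter_filter, filter_filter]
    congr 1
    refine sum_congr rfl fun T _ => ?_
    rw [smul_smul, pow_succ]
    congr 1
    ring
  have h2 : ampLap F S (insert i R) = a + b := by
    rw [hb', ha, ampLap, ← sum_filter_not_add_sum_filter _ (fun T => i ∈ T),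
      filter_filter, filter_filter]
    congr 1
    · refine sum_congr rfl fun T hT => ?_
      rw [inter_insert_of_notMem (mem_filter.1 hT).2.2]
    · refine sum_congr rfl fun T hT => ?_
      rw [inter_insert_of_mem (mem_filter.1 hT).2.2, card_insert_of_notMem]
      simp [hR]
  rw [h1, h2]
  refine expect_sq_avg_step μi hnn hsum U i a b ?_ ?_
  · rw [ha, map_sum]
    refine sum_congr rfl fun T hT => ?_
    rw [map_smul, hF1 T i (mem_filter.1 hT).2.2]
  · rw [hb', map_sum]
    refine sum_eq_zero fun T hT => ?_
    rw [map_smul, hF0 T i (mem_filter.1 hT).2.2, smul_zero]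

theorem expect_pow_four_le_sum (hnn : ∀ i x, 0 ≤ μi i x) (hsum : ∀ i, ∑ x, μi i x = 1)
    (F : Finset (Fin k) → (∀ i, V i) → ℝ) (hF0 : ∀ T, ∀ i ∈ T, avg μi {i} (F T) = 0)
    (hF1 : ∀ T, ∀ i ∉ T, avg μi {i} (F T) = F T) (R : Finset (Fin k)) :
    expect (prodMeasure μi) ((∑ T, F T) ^ 4) ≤
      ∑ S ∈ R.powerset,
        expect (prodMeasure μi) (avg μi (R \ S) (ampLap F S R * ampLap F S R) ^ 2) := by
  induction R using Finset.induction_on with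
  | empty =>
    simp only [powerset_empty, sum_singleton, sdiff_empty, avg_empty μi hsum]
    refine le_of_eq (congrArg _ ?_)
    have : ampLap F ∅ ∅ = ∑ T, F T := by simp [ampLap]
    rw [this]
    ring
  | insert i R hi ih =>
    refine ih.trans ?_
    rw [sum_powerset_insert hi, ← sum_add_distrib]
    refine sum_le_sum fun S hS => ?_
    have hiS : i ∉ S := fun h => hi (mem_powerset.1 hS h)
    rw [insert_sdiff_of_notMem _ hiS, insert_sdiff_insert, sdiff_insert_of_notMem hi]
    exact ampLap_step μi hnn hsum F hF0 hF1 _ S R hi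

theorem card_filter_subset (T : Finset (Fin k)) :
    (univ.filter fun S : Finset (Fin k) => S ⊆ T).card = 2 ^ T.card := by
  rw [← card_powerset]
  congr 1
  ext S
  simp

end Hypercontractivity

theorem statement8 (k : ℕ) (hk : 1 ≤ k)
    (V : Fin k → Type) [∀ i, Fintype (V i)] [∀ i, DecidableEq (V i)]
    (μi : ∀ i, V i → ℝ) (hnn : ∀ i x, 0 ≤ μi i x) (hsum : ∀ i, ∑ x, μi i x = 1)
    (d : ℕ) (δ : ℝ) (f : (∀ i, V i) → ℝ) (hdeg : DegLe (prodMeasure μi) d f)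
    (hglob : ∀ S : Finset (Fin k), S.card ≤ d → ∀ x, 0 < marg (prodMeasure μi) S x →
      Inf (prodMeasure μi) S f x ≤ δ) :
    norm4p4 (prodMeasure μi) f ≤ δ * 2000 ^ d * normSq (prodMeasure μi) f := by
  set μ := prodMeasure μi with hμ
  have hμ0 : ∀ x, 0 ≤ μ x := prodMeasure_nonneg μi hnn
  set F := comp μi f with hF
  have hF0 : ∀ T, ∀ i ∈ T, avg μi {i} (F T) = 0 := fun T i => avg_comp_of_mem μi hsum f
  have hF1 : ∀ T, ∀ i ∉ T, avg μi {i} (F T) = F T := fun T i => avg_comp_of_notMem μi hsum f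
  have hvan : ∀ T : Finset (Fin k), d < T.card → ∀ x, 0 < μ x → F T x = 0 := fun T hT x hx => by
    rw [hF, ← ES_prodMeasure μi hnn hsum T f hx, hdeg T hT x]
  let L : Finset (Fin k) → (∀ i, V i) → ℝ := fun S => ∑ T with S ⊆ T, F T
  have hLap : ∀ S x, 0 < μ x → Lap μ S f x = L S x := fun S x hx => by
    simp only [Lap, powerset_univ, L, Finset.sum_apply]
    exact sum_congr rfl fun T _ => ES_prodMeasure μi hnn hsum T f hx
  have hInf : ∀ S x, 0 < μ x → Inf μ S f x = avg μi Sᶜ (L S * L S) x := fun S x hx => by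
    have h := Aop_prodMeasure μi hsum S (fun z => Lap μ S f z ^ 2)
      (marg_pos_of_prodMeasure_pos μi hnn hsum S hx)
    refine h.trans (avg_congr_support μi hnn _ (fun z hz => ?_) hx)
    rw [hLap S z hz, Pi.mul_apply, sq]
  have hdistinct : ∀ S : Finset (Fin k), ∀ T ∈ univ.filter (fun T => S ⊆ T),
      ∀ T' ∈ univ.filter (fun T => S ⊆ T), T ∩ Sᶜ = T' ∩ Sᶜ → T = T' := by
    intro S T hT T' hT' h
    ext j
    by_cases hj : j ∈ S
    · simp [(mem_filter.1 hT).2 hj, (mem_filter.1 hT').2 hj]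
    · simpa [hj] using congrArg (j ∈ ·) h
  have hLsq : ∀ S, avg μi Sᶜ (L S * L S) = ∑ T with S ⊆ T, avg μi Sᶜ (F T * F T) := fun S => by
    simpa using avg_sq_sum μi hsum Sᶜ F hF0 hF1 (fun _ => 1) _ (hdistinct S)
  have hamp : ∀ S x, 0 < μ x →
      avg μi Sᶜ (ampLap F S univ * ampLap F S univ) x ≤ 4 ^ d * avg μi Sᶜ (L S * L S) x := by
    intro S x hx
    have h := avg_sq_sum μi hsum Sᶜ F hF0 hF1 (fun T => 2 ^ (T ∩ univ).card) _ (hdistinct S)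
    rw [hLsq S, ampLap, h, Finset.sum_apply, Finset.sum_apply, mul_sum]
    refine sum_le_sum fun T _ => ?_
    rw [Pi.smul_apply, smul_eq_mul, inter_univ, ← pow_mul, mul_comm T.card, pow_mul]
    rcases le_or_gt T.card d with hT | hT
    · refine mul_le_mul_of_nonneg_right ?_ (avg_nonneg μi hnn _ (fun z => mul_self_nonneg _) x)
      norm_num
      exact pow_le_pow_right₀ (by norm_num) hT
    · have : avg μi Sᶜ (F T * F T) x = avg μi Sᶜ 0 x :=
        avg_congr_support μi hnn _ (fun z hz => by simp [hvan T hT z hz]) hx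
      simp [this]
  have hL0 : ∀ S x, 0 ≤ avg μi Sᶜ (L S * L S) x := fun S =>
    avg_nonneg μi hnn _ fun z => mul_self_nonneg _
  have hamp0 : ∀ S x, 0 ≤ avg μi Sᶜ (ampLap F S univ * ampLap F S univ) x := fun S =>
    avg_nonneg μi hnn _ fun z => mul_self_nonneg _
  have hδ : 0 ≤ δ := by
    obtain ⟨x, -, hx⟩ : ∃ x ∈ univ, 0 < μ x := by
      by_contra! h
      have := sum_nonpos h
      rw [hμ, sum_prodMeasure μi hsum] at this
      norm_num at this
    refine le_trans ?_ (hglob ∅ (by simp) x (marg_pos_of_prodMeasure_pos μi hnn hsum ∅ hx))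
    rw [hInf ∅ x hx]
    exact hL0 ∅ x
  have hterm : ∀ S, expect μ (avg μi (univ \ S) (ampLap F S univ * ampLap F S univ) ^ 2) ≤
      δ * 16 ^ d * ∑ T with S ⊆ T, expect μ (F T * F T) := by
    intro S
    have e : expect μ ((δ * 16 ^ d) • avg μi Sᶜ (L S * L S)) =
        δ * 16 ^ d * ∑ T with S ⊆ T, expect μ (F T * F T) := by
      rw [expect_smul, hLsq, expect_sum]
      simp only [hμ, expect_avg μi hsum]
    rw [← e, ← compl_eq_univ_sdiff]
    refine expect_mono hμ0 fun x hx => ?_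
    simp only [Pi.pow_apply, Pi.smul_apply, smul_eq_mul]
    have hle : avg μi Sᶜ (L S * L S) x ≤ δ := by
      rcases le_or_gt S.card d with hS | hS
      · rw [← hInf S x hx]
        exact hglob S hS x (marg_pos_of_prodMeasure_pos μi hnn hsum S hx)
      · have : avg μi Sᶜ (L S * L S) x = avg μi Sᶜ 0 x := by
          refine avg_congr_support μi hnn _ (fun z hz => ?_) hx
          have : L S z = 0 := by
            simp only [L, Finset.sum_apply]
            exact sum_eq_zero fun T hT =>
              hvan T (hS.trans_le (card_le_card (mem_filter.1 hT).2)) z hz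
          simp [this]
        simpa [this] using hδ
    calc avg μi Sᶜ (ampLap F S univ * ampLap F S univ) x ^ 2
        ≤ (4 ^ d * avg μi Sᶜ (L S * L S) x) ^ 2 :=
          pow_le_pow_left₀ (hamp0 S x) (hamp S x hx) 2
      _ = 16 ^ d * avg μi Sᶜ (L S * L S) x * avg μi Sᶜ (L S * L S) x := by
          rw [mul_pow, ← pow_mul, mul_comm d, pow_mul]
          norm_num
          ring
      _ ≤ 16 ^ d * δ * avg μi Sᶜ (L S * L S) x := by
          gcongr
          exact hL0 S x
      _ = δ * 16 ^ d * avg μi Sᶜ (L S * L S) x := by ring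
  have hnorm : normSq μ f = ∑ T, expect μ (F T * F T) := by
    have h := congrArg (expect μ) (hLsq ∅)
    rw [hμ, expect_avg μi hsum, expect_sum] at h
    simp only [expect_avg μi hsum, L, empty_subset, filter_true, hF, sum_comp μi hsum] at h
    rw [← h]
    exact sum_congr rfl fun x _ => by rw [Pi.mul_apply, sq]
  have hF20 : ∀ T, 0 ≤ expect μ (F T * F T) := fun T =>
    expect_nonneg hμ0 fun x => mul_self_nonneg _
  have hdouble : ∑ S : Finset (Fin k), ∑ T with S ⊆ T, expect μ (F T * F T) ≤
      2 ^ d * normSq μ f := by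
    simp only [sum_filter]
    rw [sum_comm, hnorm, mul_sum]
    refine sum_le_sum fun T _ => ?_
    rw [← sum_filter, sum_const, card_filter_subset, nsmul_eq_mul]
    push_cast
    rcases le_or_gt T.card d with hT | hT
    · exact mul_le_mul_of_nonneg_right (pow_le_pow_right₀ (by norm_num) hT) (hF20 T)
    · have : expect μ (F T * F T) ≤ expect μ 0 :=
        expect_mono hμ0 fun x hx => by simp [hvan T hT x hx]
      have : expect μ (F T * F T) = 0 := le_antisymm (by simpa [expect] using this) (hF20 T)
      simp [this]
  have hN : 0 ≤ normSq μ f := by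
    rw [hnorm]
    exact sum_nonneg fun T _ => hF20 T
  have hmain := expect_pow_four_le_sum μi hnn hsum F hF0 hF1 univ
  rw [hF, sum_comp μi hsum, ← hF, powerset_univ] at hmain
  calc norm4p4 μ f ≤ _ := hmain
    _ ≤ ∑ S : Finset (Fin k), δ * 16 ^ d * ∑ T with S ⊆ T, expect μ (F T * F T) :=
        sum_le_sum fun S _ => hterm S
    _ = δ * 16 ^ d * ∑ S : Finset (Fin k), ∑ T with S ⊆ T, expect μ (F T * F T) := by
        rw [mul_sum]
    _ ≤ δ * 16 ^ d * (2 ^ d * normSq μ f) := by gcongr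
    _ = δ * 32 ^ d * normSq μ f := by
        rw [show (32 : ℝ) = 16 * 2 by norm_num, mul_pow]
        ring
    _ ≤ δ * 2000 ^ d * normSq μ f := by
        gcongr
        norm_num

end GLL
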